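/- The m tuples δ¹, δ², …, δ^m are pairwise distinct elements of W^odd, and they are pairwise incomparable in the order ⪯: for i ≠ j, neither δ^i ⪯ δ^j nor δ^j ⪯ δ^i. -/

import Mathlib

/-- Roots of `R⁺ \ R_P⁺`: the formal symbols `t_i - t_j`, `t_i + t_j` and `2 t_i`. -/
inductive OddRoot : Type where
  | tminus (i j : ℕ) : OddRoot
  | tplus (i j : ℕ) : OddRoot
  | double (i : ℕ) : OddRoot
deriving DecidableEq

namespace OddRoot

/-- The conditions for a formal symbol to be a root of `R⁺ \ R_P⁺`. -/
def valid (n m : ℕ) : OddRoot → Prop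
  | tminus i j => 1 ≤ i ∧ i ≤ m ∧ i < j ∧ j ≤ n + 1
  | tplus i j => 1 ≤ i ∧ i ≤ m ∧ i < j ∧ j ≤ n + 1
  | double i => 1 ≤ i ∧ i ≤ m

/-- The reflection associated to a root, as a (signed) permutation of the
ground set `{1,…,2n+2}` inside `ℕ`, where `ī = 2n+3-i`. -/
def refl (n : ℕ) : OddRoot → Equiv.Perm ℕ
  | tminus i j => Equiv.swap i j * Equiv.swap (2*n+3-i) (2*n+3-j)
  | tplus i j => Equiv.swap i (2*n+3-j) * Equiv.swap j (2*n+3-i)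
  | double i => Equiv.swap i (2*n+3-i)

/-- The degree vector of a root: `deg α k` is the coefficient of the `k`-th
simple coroot in `α∨`. -/
def deg : OddRoot → ℕ → ℤ
  | tminus i j, k => if i ≤ k ∧ k < j then 1 else 0
  | tplus i j, k => (if i ≤ k then (1:ℤ) else 0) + (if j ≤ k then 1 else 0)
  | double i, k => if i ≤ k then 1 else 0

end OddRoot

/-- The total degree of a chain of roots. -/
def chainDeg (L : List OddRoot) (k : ℕ) : ℤ := (L.map (fun α => α.deg k)).sum

/-- `IsChainTo n m L lam` : the sequence of roots `L = [α₁,…,α_t]` is a chain from the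
identity coset to the tuple `lam`, i.e. each `αᵢ` is in `R⁺ \ R_P⁺` and the composite
`w = s_{α₁} ∘ ⋯ ∘ s_{α_t}` satisfies `w i = lam i` for `1 ≤ i ≤ m`. -/
def IsChainTo (n m : ℕ) (L : List OddRoot) (lam : ℕ → ℕ) : Prop :=
  (∀ α ∈ L, α.valid n m) ∧
  ∀ i ∈ Finset.Icc 1 m, ((L.map (OddRoot.refl n)).prod) i = lam i

/-- `W^odd`: tuples `(lam 1, …, lam m)` of pairwise distinct elements of `{1,…,2n+1}`
with no two entries summing to `2n+3`. -/
def Wodd (n m : ℕ) (lam : ℕ → ℕ) : Prop :=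
  (∀ i ∈ Finset.Icc 1 m, lam i ∈ Finset.Icc 1 (2*n+1)) ∧
  (∀ i ∈ Finset.Icc 1 m, ∀ j ∈ Finset.Icc 1 m, i ≠ j → lam i ≠ lam j) ∧
  (∀ i ∈ Finset.Icc 1 m, ∀ j ∈ Finset.Icc 1 m, lam i + lam j ≠ 2*n+3)

/-- `LamEntry lam k i = Λᵏᵢ`, the `i`-th smallest element of `{lam 1, …, lam k}`. -/
def LamEntry (lam : ℕ → ℕ) (k i : ℕ) : ℕ :=
  (((Finset.Icc 1 k).image lam).sort (· ≤ ·)).getD (i-1) 0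

/-- The Bruhat-type order `λ ⪯ δ`: `Λᵏᵢ ≤ Δᵏᵢ` for all `1 ≤ i ≤ k ≤ m`. -/
def Dominates (m : ℕ) (lam del : ℕ → ℕ) : Prop :=
  ∀ k ∈ Finset.Icc 1 m, ∀ i ∈ Finset.Icc 1 k, LamEntry lam k i ≤ LamEntry del k i

/-- The tuples `δʲ`: `δ¹ = ((m+1)̄ | 2 | 3 | ⋯ | m)` and, for `2 ≤ j ≤ m`,
`δʲ = (j̄ | 2 | ⋯ | j-1 | 1 | j+1 | ⋯ | m)`. -/
def delta (n m j : ℕ) : ℕ → ℕ := fun i =>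
  if j = 1 then (if i = 1 then 2*n+2-m else i)
  else if i = 1 then 2*n+3-j else if i = j then 1 else i

/-- The pattern vector `(0^a 1^b c^(m-a-b))`. -/
def patvec (a b : ℕ) (c : ℤ) : ℕ → ℤ := fun k =>
  if k ≤ a then 0 else if k ≤ a + b then 1 else c

/-- The simple reflections `s_k` (`1 ≤ k ≤ n`, swapping `k ↔ k+1` and `k̄ ↔ (k+1)̄`)
and `s_{n+1}` (swapping `n+1 ↔ (n+1)̄ = n+2`). -/
def simpleRefl (n k : ℕ) : Equiv.Perm ℕ :=
  if k ≤ n then Equiv.swap k (k+1) * Equiv.swap (2*n+3-k) (2*n+2-k)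
  else Equiv.swap (n+1) (n+2)

theorem LamEntry_one (lam : ℕ → ℕ) (k : ℕ) (hk : 1 ≤ k) :
    (∃ a ∈ Finset.Icc 1 k, LamEntry lam k 1 = lam a) ∧
    ∀ a ∈ Finset.Icc 1 k, LamEntry lam k 1 ≤ lam a := by
  have key : ∀ a ∈ Finset.Icc 1 k,
      lam a ∈ ((Finset.Icc 1 k).image lam).sort (· ≤ ·) := by
    intro a ha
    rw [Finset.mem_sort]
    exact Finset.mem_image_of_mem _ ha
  have key2 : ∀ x ∈ ((Finset.Icc 1 k).image lam).sort (· ≤ ·),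
      ∃ a ∈ Finset.Icc 1 k, x = lam a := by
    intro x hx
    rw [Finset.mem_sort, Finset.mem_image] at hx
    obtain ⟨a, ha, h⟩ := hx
    exact ⟨a, ha, h.symm⟩
  have hs : (((Finset.Icc 1 k).image lam).sort (· ≤ ·)).Pairwise (· ≤ ·) :=
    Finset.pairwise_sort _ _
  unfold LamEntry
  generalize ((Finset.Icc 1 k).image lam).sort (· ≤ ·) = l at *
  cases l with
  | nil =>
    have := key 1 (Finset.mem_Icc.2 ⟨le_refl _, hk⟩)
    simp at this
  | cons b t =>
    rw [List.pairwise_cons] at hs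
    refine ⟨?_, ?_⟩
    · simpa using key2 b (by simp)
    · intro a ha
      have h := key a ha
      rw [List.mem_cons] at h
      simp only [Nat.sub_self, List.getD_cons_zero]
      rcases h with h | h
      · exact h.ge
      · exact hs.1 _ h

theorem delta_incomp (n m i j : ℕ) (hmn : m ≤ n) (hi : 2 ≤ i) (him : i ≤ m)
    (hj1 : 1 ≤ j) (hjm : j ≤ m) (hij : j = 1 ∨ i < j) :
    (∃ k ∈ Finset.Icc 1 m, delta n m i k ≠ delta n m j k) ∧
      ¬ Dominates m (delta n m i) (delta n m j) ∧
      ¬ Dominates m (delta n m j) (delta n m i) := by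
  have h1 : delta n m j 1 < delta n m i 1 := by
    unfold delta
    split_ifs <;> omega
  refine ⟨⟨1, Finset.mem_Icc.2 ⟨le_refl _, by omega⟩, h1.ne'⟩, ?_, ?_⟩
  · intro h
    have h := h 1 (Finset.mem_Icc.2 ⟨le_refl _, by omega⟩) 1 (by simp)
    obtain ⟨a, ha, e⟩ := (LamEntry_one (delta n m i) 1 le_rfl).1
    have e2 := (LamEntry_one (delta n m j) 1 le_rfl).2 1 (by simp)
    obtain rfl : a = 1 := by simpa using ha
    omega
  · intro h
    have h := h i (Finset.mem_Icc.2 ⟨by omega, him⟩) 1 (Finset.mem_Icc.2 ⟨le_refl _, by omega⟩)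
    obtain ⟨a, ha, e⟩ := (LamEntry_one (delta n m j) i (by omega)).1
    have e2 := (LamEntry_one (delta n m i) i (by omega)).2 i
      (Finset.mem_Icc.2 ⟨by omega, le_rfl⟩)
    rw [Finset.mem_Icc] at ha
    have e3 : delta n m i i = 1 := by
      unfold delta
      split_ifs <;> omega
    have e4 : 2 ≤ delta n m j a := by
      unfold delta
      split_ifs <;> omega
    omega

/-- the tuples `δ¹, …, δᵐ` are pairwise distinct elements of `W^odd` and are
pairwise incomparable in the order `⪯`. -/
theorem deltas_distinct_incomparable (n m : ℕ) (hn : 1 ≤ n) (hm : 1 ≤ m) (hmn : m ≤ n) :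
    (∀ j, 1 ≤ j → j ≤ m → Wodd n m (delta n m j)) ∧
    (∀ i j, 1 ≤ i → i ≤ m → 1 ≤ j → j ≤ m → i ≠ j →
      (∃ k ∈ Finset.Icc 1 m, delta n m i k ≠ delta n m j k) ∧
      ¬ Dominates m (delta n m i) (delta n m j) ∧
      ¬ Dominates m (delta n m j) (delta n m i)) := by
  refine ⟨?_, ?_⟩
  · intro j hj hjm
    refine ⟨?_, ?_, ?_⟩
    · intro a ha
      rw [Finset.mem_Icc] at *
      unfold delta
      split_ifs <;> omega
    · intro a ha b hb hab
      rw [Finset.mem_Icc] at *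
      unfold delta
      split_ifs <;> omega
    · intro a ha b hb
      rw [Finset.mem_Icc] at *
      unfold delta
      split_ifs <;> omega
  · intro i j hi him hj hjm hij
    by_cases h : 2 ≤ i ∧ (j = 1 ∨ i < j)
    · exact delta_incomp n m i j hmn h.1 him hj hjm h.2
    · obtain ⟨⟨k, hk, h1⟩, h2, h3⟩ :=
        delta_incomp n m j i hmn (by omega) hjm hi him (by omega)
      exact ⟨⟨k, hk, h1.symm⟩, h3, h2⟩
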